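/- For all integers 2 ≤ m < n, res(Ψ_m(x), Ψ_n(x)) = p^{φ(m)} if n/m = p^α for some prime p and positive integer α, and res(Ψ_m(x), Ψ_n(x)) = 1 otherwise. -/

import Mathlib

open Polynomial

/-- The Fibonacci polynomials: `F 1 = 1`, `F 2 = X`, `F (n+2) = X * F (n+1) + F n`. -/
noncomputable def fibPoly : ℕ → Polynomial ℤ
  | 0 => 0
  | 1 => 1
  | n + 2 => X * fibPoly (n + 1) + fibPoly n

/-- The resultant of two monic polynomials that split over `ℂ`, computed as
`∏_{i,j} (αᵢ - βⱼ)` over the roots `αᵢ` of `f` and `βⱼ` of `g`. -/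
noncomputable def resC (f g : Polynomial ℂ) : ℂ :=
  (f.roots.map (fun a => (g.roots.map (fun b => a - b)).prod)).prod

theorem fp_zero : fibPoly 0 = 0 := by rw [fibPoly]
theorem fp_one : fibPoly 1 = 1 := by rw [fibPoly]
theorem fp_rec (n : ℕ) : fibPoly (n + 2) = X * fibPoly (n + 1) + fibPoly n := by rw [fibPoly]

theorem fp_add (a b : ℕ) :
    fibPoly (a + b + 1) = fibPoly (a + 1) * fibPoly (b + 1) + fibPoly a * fibPoly b := by
  induction b using Nat.twoStepInduction with
  | zero => simp [fp_zero, fp_one]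
  | one => simp [fp_rec, fp_zero, fp_one]; ring
  | more b h1 h2 =>
    rw [show a + (b + 2) + 1 = (a + b + 1) + 2 by ring, fp_rec, 
      show a + b + 1 + 1 = a + (b + 1) + 1 by ring, h1, h2, fp_rec (b + 1), fp_rec b]
    ring

theorem fp_add' (a b : ℕ) :
    fibPoly (a + b) = fibPoly (a + 1) * fibPoly b
      + fibPoly a * (fibPoly (b + 1) - X * fibPoly b) := by
  cases b with
  | zero => simp [fp_zero, fp_one]
  | succ b => rw [← add_assoc, fp_add, fp_rec]; ring

theorem fp_coprime (n : ℕ) : IsCoprime (fibPoly n) (fibPoly (n + 1)) := by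
  induction n with
  | zero => simp [fp_one, isCoprime_one_right]
  | succ n ih =>
    have h := IsCoprime.add_mul_right_right ih.symm X
    rwa [add_comm (fibPoly n), ← fp_rec] at h

theorem fp_key (m k : ℕ) :
    fibPoly m ∣ fibPoly (m * k + 1) - fibPoly (m + 1) ^ k ∧
    fibPoly m ^ 2 ∣ fibPoly (m * (k + 1)) - (k + 1 : ℕ) * fibPoly m * fibPoly (m + 1) ^ k := by
  have hd : ∀ k, fibPoly m ∣ fibPoly (m * k) := by
    intro k
    induction k with
    | zero => simp [fp_zero]
    | succ k ih =>
      rw [mul_add, mul_one, fp_add']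
      exact dvd_add (dvd_mul_of_dvd_right dvd_rfl _) (dvd_mul_of_dvd_left ih _)
  have h1 : ∀ k, fibPoly m ∣ fibPoly (m * k + 1) - fibPoly (m + 1) ^ k := by
    intro k
    induction k with
    | zero => simp [fp_one]
    | succ k ih =>
      obtain ⟨c, hc⟩ := ih
      refine ⟨c * fibPoly (m + 1) + fibPoly (m * k), ?_⟩
      rw [mul_add, mul_one, fp_add, pow_succ]
      linear_combination fibPoly (m + 1) * hc
  refine ⟨h1 k, ?_⟩
  induction k with
  | zero => simp
  | succ k ih =>
    obtain ⟨c, hc⟩ := ih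
    obtain ⟨d, hd'⟩ := h1 (k + 1)
    obtain ⟨e, he⟩ := hd (k + 1)
    refine ⟨d + c * fibPoly (m + 1) - X * e, ?_⟩
    rw [mul_add m (k + 1) 1, mul_one, fp_add']
    push_cast at hc ⊢
    linear_combination fibPoly m * hd' + fibPoly (m + 1) * hc - X * fibPoly m * he

theorem fp_dvd (m k : ℕ) : fibPoly m ∣ fibPoly (m * k) := by
  cases k with
  | zero => simp [fp_zero]
  | succ k =>
    have h := (fp_key m k).2
    have h2 : fibPoly m ∣ fibPoly m ^ 2 := dvd_pow_self _ (by norm_num)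
    have h3 := (h2.trans h).add
      (show fibPoly m ∣ (k + 1 : ℕ) * fibPoly m * fibPoly (m + 1) ^ k from
        ⟨(k + 1 : ℕ) * fibPoly (m + 1) ^ k, by ring⟩)
    simpa using h3

theorem fp_gcd (m n : ℕ) (I : Ideal ℤ[X]) :
    fibPoly m ∈ I → fibPoly n ∈ I → fibPoly (Nat.gcd m n) ∈ I := by
  induction m, n using Nat.gcd.induction with
  | H0 n => intro _ h; simpa using h
  | H1 m n hm ih =>
    intro h1 h2
    rw [Nat.gcd_rec]
    refine ih ?_ h1
    have hM : fibPoly (m * (n / m)) ∈ I := I.mem_of_dvd (fp_dvd _ _) h1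
    have e := fp_add' (m * (n / m)) (n % m)
    rw [Nat.div_add_mod] at e
    obtain ⟨u, v, huv⟩ := fp_coprime (m * (n / m))
    have e2 : fibPoly (n % m) = v * fibPoly n + (u * fibPoly (n % m)
        - v * (fibPoly (n % m + 1) - X * fibPoly (n % m))) * fibPoly (m * (n / m)) := by
      rw [e]; linear_combination (-fibPoly (n % m)) * huv
    rw [e2]
    exact I.add_mem (I.mul_mem_left _ h2) (I.mul_mem_left _ hM)

theorem fp_monic_deg (n : ℕ) :
    (fibPoly (n + 1)).Monic ∧ (fibPoly (n + 1)).natDegree = n := by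
  induction n using Nat.twoStepInduction with
  | zero => simp [fp_one]
  | one => simp [fp_rec, fp_one, fp_zero, monic_X]
  | more n h1 h2 =>
    rw [fp_rec (n + 1)]
    have hX : (X * fibPoly (n + 1 + 1)).Monic := monic_X.mul h2.1
    have hXd : (X * fibPoly (n + 1 + 1)).natDegree = n + 2 := by
      rw [monic_X.natDegree_mul h2.1, h2.2, natDegree_X]; ring
    have hlt : (fibPoly (n + 1)).natDegree < (X * fibPoly (n + 1 + 1)).natDegree := by
      rw [h1.2, hXd]; omega
    exact ⟨hX.add_of_left (degree_lt_degree hlt),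
      by rw [natDegree_add_eq_left_of_natDegree_lt hlt, hXd]⟩

theorem fp_comp (n : ℕ) :
    (fibPoly (n + 1)).comp (-X) = (-1) ^ n * fibPoly (n + 1) := by
  induction n using Nat.twoStepInduction with
  | zero => simp [fp_one]
  | one => simp [fp_rec, fp_one, fp_zero]
  | more n h1 h2 =>
    rw [fp_rec (n + 1), add_comp, mul_comp, X_comp, h1, h2]
    ring

theorem fp_pos (n : ℕ) (x : ℝ) (hx : 0 < x) : 0 < aeval x (fibPoly (n + 1)) := by
  induction n using Nat.twoStepInduction with
  | zero => simp [fp_one]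
  | one => simp [fp_rec, fp_one, fp_zero, hx]
  | more n h1 h2 =>
    rw [fp_rec (n + 1), map_add, map_mul, aeval_X]
    positivity

section Psi

variable {Ψ : ℕ → Polynomial ℤ}

theorem psi_split (hΨprod : ∀ n, 1 ≤ n → fibPoly n = ∏ d ∈ n.divisors, Ψ d)
    {d n : ℕ} (hn : 1 ≤ n) (h : d ∣ n) :
    fibPoly n = fibPoly d * ∏ e ∈ n.divisors \ d.divisors, Ψ e := by
  have hd : 1 ≤ d := Nat.pos_of_dvd_of_pos h hn
  rw [hΨprod n hn, hΨprod d hd, mul_comm, Finset.prod_sdiff]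
  exact Nat.divisors_subset_of_dvd (by omega) h

theorem psi_self (hΨprod : ∀ n, 1 ≤ n → fibPoly n = ∏ d ∈ n.divisors, Ψ d)
    {n : ℕ} (hn : 1 ≤ n) :
    fibPoly n = Ψ n * ∏ e ∈ n.properDivisors, Ψ e := by
  rw [hΨprod n hn, ← Nat.insert_self_properDivisors (by omega), Finset.prod_insert (by simp)]

theorem psi_deg (hΨ1 : Ψ 1 = 1) (hΨmonic : ∀ n, 1 ≤ n → (Ψ n).Monic)
    (hΨprod : ∀ n, 1 ≤ n → fibPoly n = ∏ d ∈ n.divisors, Ψ d)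
    (n : ℕ) (hn : 2 ≤ n) : (Ψ n).natDegree = Nat.totient n := by
  have key : ∀ n, 1 ≤ n → (Ψ n).natDegree + (if n = 1 then 1 else 0) = Nat.totient n := by
    intro n
    induction n using Nat.strong_induction_on with
    | _ n ih =>
      intro hn
      have h1 : ∑ d ∈ n.divisors, ((Ψ d).natDegree + (if d = 1 then 1 else 0)) = n := by
        rw [Finset.sum_add_distrib, ← natDegree_prod_of_monic _ _
          (fun d hd => hΨmonic d (Nat.pos_of_mem_divisors hd)), ← hΨprod n hn]
        obtain ⟨k, rfl⟩ : ∃ k, n = k + 1 := ⟨n - 1, by omega⟩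
        rw [(fp_monic_deg k).2]
        simp
      have h2 := Nat.sum_totient n
      rw [← h1] at h2
      conv_lhs at h2 => rw [h1]
      rw [← Nat.insert_self_properDivisors (by omega), Finset.sum_insert (by simp),
        Finset.sum_insert (by simp)] at h2
      have h3 : ∑ d ∈ n.properDivisors, ((Ψ d).natDegree + (if d = 1 then 1 else 0)) =
          ∑ d ∈ n.properDivisors, Nat.totient d := by
        refine Finset.sum_congr rfl fun d hd => ih d ?_ (Nat.pos_of_mem_properDivisors hd)
        exact (Nat.mem_properDivisors.1 hd).2
      omega
  have := key n (by omega)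
  rw [if_neg (by omega)] at this
  simpa using this

theorem psi_comp (hΨmonic : ∀ n, 1 ≤ n → (Ψ n).Monic)
    (hΨprod : ∀ n, 1 ≤ n → fibPoly n = ∏ d ∈ n.divisors, Ψ d)
    (n : ℕ) : 1 ≤ n → (Ψ n).comp (-X) = (-1) ^ (Ψ n).natDegree * Ψ n := by
  induction n using Nat.strong_induction_on with
  | _ n ih =>
    intro hn
    have hm : ∀ d ∈ n.properDivisors, (Ψ d).Monic :=
      fun d hd => hΨmonic d (Nat.pos_of_mem_properDivisors hd)
    have hM := monic_prod_of_monic _ _ hm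
    set P := ∏ e ∈ n.properDivisors, Ψ e with hP
    have e := psi_self hΨprod hn
    rw [← hP] at e
    have h1 : P.comp (-X) = (-1) ^ P.natDegree * P := by
      rw [hP, natDegree_prod_of_monic _ _ hm, ← Finset.prod_pow_eq_pow_sum,
        ← Finset.prod_mul_distrib, prod_comp]
      exact Finset.prod_congr rfl fun d hd =>
        ih d (Nat.mem_properDivisors.1 hd).2 (Nat.pos_of_mem_properDivisors hd)
    obtain ⟨k, rfl⟩ : ∃ k, n = k + 1 := ⟨n - 1, by omega⟩
    have h2 := fp_comp k
    have h3 := (fp_monic_deg k).2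
    rw [e, (hΨmonic _ hn).natDegree_mul hM] at h3
    have h5 : (-1 : ℤ[X]) ^ k = (-1) ^ (Ψ (k + 1)).natDegree * (-1) ^ P.natDegree := by
      rw [← pow_add, h3]
    rw [e, mul_comp, h1, h5] at h2
    have h4 : ((-1 : ℤ[X]) ^ P.natDegree * P) ≠ 0 :=
      mul_ne_zero (pow_ne_zero _ (by norm_num)) hM.ne_zero
    apply mul_right_cancel₀ h4
    rw [h2]; ring

theorem psi_pos (hΨprod : ∀ n, 1 ≤ n → fibPoly n = ∏ d ∈ n.divisors, Ψ d)
    (x : ℝ) (hx : 0 < x) (n : ℕ) : 1 ≤ n → 0 < aeval x (Ψ n) := by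
  induction n using Nat.strong_induction_on with
  | _ n ih =>
    intro hn
    have e := psi_self hΨprod hn
    obtain ⟨k, rfl⟩ : ∃ k, n = k + 1 := ⟨n - 1, by omega⟩
    have h := fp_pos k x hx
    rw [e, map_mul, map_prod] at h
    refine pos_of_mul_pos_left h (Finset.prod_nonneg fun d hd => ?_)
    exact (ih d (Nat.mem_properDivisors.1 hd).2 (Nat.pos_of_mem_properDivisors hd)).le

theorem psi_coprime (hΨmonic : ∀ n, 1 ≤ n → (Ψ n).Monic)
    (hΨprod : ∀ n, 1 ≤ n → fibPoly n = ∏ d ∈ n.divisors, Ψ d)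
    (m n : ℕ) (hm : 1 ≤ m) (hn : 1 ≤ n) (h1 : ¬ m ∣ n) (h2 : ¬ n ∣ m) :
    IsCoprime (Ψ m) (Ψ n) := by
  have hg := Ideal.mem_span_pair.1 (fp_gcd m n (Ideal.span {fibPoly m, fibPoly n})
    (Ideal.subset_span (by simp)) (Ideal.subset_span (by simp)))
  obtain ⟨A, B, hAB⟩ := hg
  have em := psi_split hΨprod hm (Nat.gcd_dvd_left m n)
  have en := psi_split hΨprod hn (Nat.gcd_dvd_right m n)
  have hm' : m ∈ m.divisors \ (Nat.gcd m n).divisors := by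
    simp only [Finset.mem_sdiff, Nat.mem_divisors]
    exact ⟨⟨dvd_rfl, by omega⟩, fun h => h1 (h.1.trans (Nat.gcd_dvd_right m n))⟩
  have hn' : n ∈ n.divisors \ (Nat.gcd m n).divisors := by
    simp only [Finset.mem_sdiff, Nat.mem_divisors]
    exact ⟨⟨dvd_rfl, by omega⟩, fun h => h2 (h.1.trans (Nat.gcd_dvd_left m n))⟩
  obtain ⟨c, hc⟩ := Finset.dvd_prod_of_mem Ψ hm'
  obtain ⟨d, hd⟩ := Finset.dvd_prod_of_mem Ψ hn'
  rw [hc] at em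
  rw [hd] at en
  have hg0 : fibPoly (Nat.gcd m n) ≠ 0 := by
    obtain ⟨k, hk⟩ : ∃ k, Nat.gcd m n = k + 1 :=
      ⟨Nat.gcd m n - 1, by have := Nat.gcd_pos_of_pos_left n hm; omega⟩
    rw [hk]; exact (fp_monic_deg k).1.ne_zero
  refine ⟨A * c, B * d, mul_left_cancel₀ hg0 ?_⟩
  rw [em, en] at hAB
  linear_combination hAB

/-- The quotient `F_{N(k+1)}/F_N` modulo `F_N`. -/
theorem psi_quot (hΨmonic : ∀ n, 1 ≤ n → (Ψ n).Monic)
    (hΨprod : ∀ n, 1 ≤ n → fibPoly n = ∏ d ∈ n.divisors, Ψ d)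
    (N k : ℕ) (hN : 1 ≤ N) :
    fibPoly N ∣ (∏ e ∈ (N * (k + 1)).divisors \ N.divisors, Ψ e)
      - (k + 1 : ℕ) * fibPoly (N + 1) ^ k := by
  have e := psi_split hΨprod (d := N) (n := N * (k + 1)) (Nat.mul_pos hN (by omega))
    (dvd_mul_right _ _)
  have h := (fp_key N k).2
  rw [e] at h
  obtain ⟨c, hc⟩ := h
  have h0 : fibPoly N ≠ 0 := by
    obtain ⟨k, rfl⟩ : ∃ k, N = k + 1 := ⟨N - 1, by omega⟩
    exact (fp_monic_deg k).1.ne_zero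
  refine ⟨c, mul_left_cancel₀ h0 ?_⟩
  linear_combination hc

theorem psi_dvd_fp (hΨprod : ∀ n, 1 ≤ n → fibPoly n = ∏ d ∈ n.divisors, Ψ d)
    (m N : ℕ) (hN : 1 ≤ N) (h : m ∣ N) : Ψ m ∣ fibPoly N := by
  rw [hΨprod N hN]
  exact Finset.dvd_prod_of_mem Ψ (by simp; exact ⟨h, by omega⟩)

theorem psi_prime_mem (hΨmonic : ∀ n, 1 ≤ n → (Ψ n).Monic)
    (hΨprod : ∀ n, 1 ≤ n → fibPoly n = ∏ d ∈ n.divisors, Ψ d)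
    (m N p : ℕ) (hN : 1 ≤ N) (hp : 2 ≤ p) (h : m ∣ N) (I : Ideal ℤ[X])
    (h1 : Ψ m ∈ I) (h2 : Ψ (N * p) ∈ I) : ((p : ℕ) : ℤ[X]) ∈ I := by
  obtain ⟨k, rfl⟩ : ∃ k, p = k + 1 := ⟨p - 1, by omega⟩
  have hq := psi_quot hΨmonic hΨprod N k hN
  have hF : fibPoly N ∈ I := I.mem_of_dvd (psi_dvd_fp hΨprod m N hN h) h1
  have hG : (∏ e ∈ (N * (k + 1)).divisors \ N.divisors, Ψ e) ∈ I := by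
    refine I.mem_of_dvd (Finset.dvd_prod_of_mem Ψ ?_) h2
    simp only [Finset.mem_sdiff, Nat.mem_divisors]
    refine ⟨⟨dvd_rfl, by positivity⟩, fun h => ?_⟩
    have := Nat.le_of_dvd hN h.1
    nlinarith
  have h3 := I.sub_mem hG (I.mem_of_dvd hq hF)
  rw [sub_sub_cancel] at h3
  obtain ⟨u, v, huv⟩ := (fp_coprime N).pow_right (n := k)
  have e2 : ((k + 1 : ℕ) : ℤ[X]) = v * ((k + 1 : ℕ) * fibPoly (N + 1) ^ k)
      + ((k + 1 : ℕ) * u) * fibPoly N := by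
    linear_combination (-((k + 1 : ℕ) : ℤ[X])) * huv
  rw [e2]
  exact I.add_mem (I.mul_mem_left _ h3) (I.mul_mem_left _ hF)

theorem psi_coprime' (hΨmonic : ∀ n, 1 ≤ n → (Ψ n).Monic)
    (hΨprod : ∀ n, 1 ≤ n → fibPoly n = ∏ d ∈ n.divisors, Ψ d)
    (m n : ℕ) (hm : 1 ≤ m) (hmn : m < n)
    (h : ¬∃ p α : ℕ, p.Prime ∧ 0 < α ∧ n = m * p ^ α) :
    IsCoprime (Ψ m) (Ψ n) := by
  by_cases hd : m ∣ n
  · obtain ⟨k, rfl⟩ := hd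
    have hk : k ≠ 1 := by rintro rfl; omega
    have hk0 : k ≠ 0 := by rintro rfl; omega
    have hp := Nat.minFac_prime hk
    set p := k.minFac with hpdef
    have hpk : p ∣ k := Nat.minFac_dvd k
    obtain ⟨q, hq, hqk, hqp⟩ : ∃ q, q.Prime ∧ q ∣ k ∧ q ≠ p := by
      by_contra! hcon
      have := Nat.eq_prime_pow_of_unique_prime_dvd hk0 (fun {d} hd1 hd2 => hcon d hd1 hd2)
      refine h ⟨p, k.primeFactorsList.length, hp, ?_, by rw [← this]⟩
      rcases Nat.eq_zero_or_pos k.primeFactorsList.length with h0 | h0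
      · rw [h0, pow_zero] at this; omega
      · exact h0
    set I := Ideal.span {Ψ m, Ψ (m * k)} with hI
    have hmem : ∀ r : ℕ, r.Prime → r ∣ k → ((r : ℕ) : ℤ[X]) ∈ I := by
      rintro r hr ⟨s, rfl⟩
      have hs : s ≠ 0 := by rintro rfl; simp at hk0
      refine psi_prime_mem hΨmonic hΨprod m (m * s) r (Nat.mul_pos hm (by omega)) hr.two_le
        (dvd_mul_right _ _) I (Ideal.subset_span (by simp)) ?_
      rw [mul_assoc, mul_comm s r]
      exact Ideal.subset_span (by simp)
    have h1 := hmem p hp hpk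
    have h2 := hmem q hq hqk
    obtain ⟨a, b, hab⟩ := Nat.isCoprime_iff_coprime.2 ((Nat.coprime_primes hp hq).2 hqp.symm)
    have h3 : (1 : ℤ[X]) = (a : ℤ[X]) * (p : ℤ[X]) + (b : ℤ[X]) * (q : ℤ[X]) := by
      exact_mod_cast congrArg (Int.cast : ℤ → ℤ[X]) hab.symm
    have h4 : (1 : ℤ[X]) ∈ I := by
      rw [h3]; exact I.add_mem (I.mul_mem_left _ h1) (I.mul_mem_left _ h2)
    obtain ⟨u, v, huv⟩ := Ideal.mem_span_pair.1 h4
    exact ⟨u, v, huv⟩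
  · exact psi_coprime hΨmonic hΨprod m n hm (by omega) hd
      (fun h => by have := Nat.le_of_dvd hm h; omega)

end Psi

/-- Product of the values of `g` at the complex roots of `f`. -/
noncomputable def rootProd (f g : ℤ[X]) : ℂ :=
  ((f.map (Int.castRingHom ℂ)).roots.map (fun a => (g.map (Int.castRingHom ℂ)).eval a)).prod

theorem resC_eq (f g : ℤ[X]) (hg : g.Monic) :
    resC (f.map (Int.castRingHom ℂ)) (g.map (Int.castRingHom ℂ)) = rootProd f g := by
  unfold resC rootProd
  congr 1
  refine Multiset.map_congr rfl fun a _ => ?_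
  rw [(IsAlgClosed.splits _).eval_eq_prod_roots_of_monic (hg.map _)]

theorem rootProd_int (f g : ℤ[X]) (hf : f.Monic) : ∃ r : ℤ, rootProd f g = r := by
  refine ⟨resultant f g (f.map (Int.castRingHom ℂ)).natDegree g.natDegree, ?_⟩
  have h := resultant_eq_prod_eval (f.map (Int.castRingHom ℂ)) (g.map (Int.castRingHom ℂ))
    g.natDegree natDegree_map_le (IsAlgClosed.splits _)
  rw [(hf.map _).leadingCoeff, one_pow, one_mul, resultant_map_map] at h
  exact h.symm

theorem rootProd_mul (f g h : ℤ[X]) : rootProd f (g * h) = rootProd f g * rootProd f h := by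
  unfold rootProd
  rw [← Multiset.prod_map_mul]
  simp

theorem rootProd_congr (f g h : ℤ[X]) (hd : f ∣ g - h) : rootProd f g = rootProd f h := by
  unfold rootProd
  congr 1
  refine Multiset.map_congr rfl fun a ha => ?_
  obtain ⟨c, hc⟩ := hd
  have h0 : (f.map (Int.castRingHom ℂ)).eval a = 0 := (mem_roots'.1 ha).2
  have := congrArg (fun q => (q.map (Int.castRingHom ℂ)).eval a) hc
  simp only [Polynomial.map_sub, Polynomial.map_mul, eval_sub, eval_mul, h0, zero_mul] at this
  exact sub_eq_zero.1 this

theorem rootProd_nat (f : ℤ[X]) (hf : f.Monic) (k : ℕ) :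
    rootProd f (k : ℤ[X]) = (k : ℂ) ^ f.natDegree := by
  unfold rootProd
  have : (f.map (Int.castRingHom ℂ)).roots.card = f.natDegree := by
    rw [← (IsAlgClosed.splits (f.map (Int.castRingHom ℂ))).natDegree_eq_card_roots,
      hf.natDegree_map]
  simp [this]

theorem rootProd_coprime (f g : ℤ[X]) (hf : f.Monic) (h : IsCoprime f g) :
    ‖rootProd f g‖ = 1 := by
  obtain ⟨u, v, huv⟩ := h
  have h1 : rootProd f (v * g) = rootProd f ((1 : ℕ) : ℤ[X]) :=
    rootProd_congr _ _ _ ⟨-u, by push_cast; linear_combination huv⟩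
  rw [rootProd_mul, rootProd_nat f hf] at h1
  obtain ⟨r, hr⟩ := rootProd_int f g hf
  obtain ⟨s, hs⟩ := rootProd_int f v hf
  rw [hr, hs] at h1
  have h2 : s * r = 1 := by
    have : ((s * r : ℤ) : ℂ) = ((1 : ℤ) : ℂ) := by push_cast; rw [h1]; simp
    exact_mod_cast this
  rw [hr]
  rcases Int.isUnit_iff.1 (IsUnit.of_mul_eq_one_right s h2) with h | h <;> simp [h]

theorem exists_expand (f : ℤ[X]) (h : f.comp (-X) = f) : ∃ P : ℤ[X], f = expand ℤ 2 P := by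
  refine ⟨contract 2 f, ?_⟩
  ext n
  rw [coeff_expand (by norm_num), coeff_contract (by norm_num)]
  split_ifs with hn
  · rw [Nat.div_mul_cancel hn]
  · have h1 := congrArg (fun q => q.coeff n) h
    rw [show (-X : ℤ[X]) = C (-1) * X by simp] at h1
    simp only [comp_C_mul_X_coeff] at h1
    rw [(Nat.not_even_iff_odd.1 (fun h => hn h.two_dvd)).neg_one_pow] at h1
    omega

theorem prod_expand (φ : ℂ → ℂ) (s : Multiset ℂ) :
    ((expand ℂ 2 (s.map (fun c => X - C c)).prod).roots.map (fun a => φ (a ^ 2))).prod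
      = (s.map φ).prod ^ 2 := by
  induction s using Multiset.induction_on with
  | empty => simp
  | cons c s ih =>
    obtain ⟨t, ht⟩ := IsAlgClosed.exists_pow_nat_eq c (n := 2) (by norm_num)
    have hM : (s.map (fun c => X - C c)).prod ≠ 0 :=
      (monic_multiset_prod_of_monic _ _ (fun c _ => monic_X_sub_C c)).ne_zero
    have hM' : expand ℂ 2 (s.map (fun c => X - C c)).prod ≠ 0 := by
      rwa [Ne, expand_eq_zero (by norm_num)]
    have e : expand ℂ 2 (X - C c) = (X - C t) * (X - C (-t)) := by
      rw [map_sub, expand_X, expand_C, ← ht]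
      simp only [map_neg, map_pow]; ring
    have h0 : (X - C t) * (X - C (-t)) ≠ 0 :=
      mul_ne_zero (X_sub_C_ne_zero _) (X_sub_C_ne_zero _)
    rw [Multiset.map_cons, Multiset.prod_cons, map_mul, e, roots_mul (mul_ne_zero h0 hM'),
      roots_mul h0, roots_X_sub_C, roots_X_sub_C, Multiset.map_add, Multiset.prod_add, ih]
    simp [ht]
    ring

theorem rootProd_expand (P Q : ℤ[X]) (hP : P.Monic) :
    rootProd (expand ℤ 2 P) (expand ℤ 2 Q) = rootProd P Q ^ 2 := by
  unfold rootProd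
  rw [map_expand, map_expand]
  have h := prod_expand (fun a => (Q.map (Int.castRingHom ℂ)).eval a)
    (P.map (Int.castRingHom ℂ)).roots
  have e := (IsAlgClosed.splits (P.map (Int.castRingHom ℂ))).eq_prod_roots
  rw [(hP.map _).leadingCoeff, C_1, one_mul] at e
  rw [← e] at h
  rw [← h]
  simp only [expand_eval]

theorem rootProd_psi_nonneg
    (Ψ : ℕ → Polynomial ℤ) (hΨ1 : Ψ 1 = 1)
    (hΨmonic : ∀ n, 1 ≤ n → (Ψ n).Monic)
    (hΨprod : ∀ n, 1 ≤ n → fibPoly n = ∏ d ∈ n.divisors, Ψ d)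
    (m n : ℕ) (hm : 2 ≤ m) (hmn : m < n) : ∃ r : ℤ, 0 ≤ r ∧ rootProd (Ψ m) (Ψ n) = r := by
  have hev : ∀ k, 3 ≤ k → ∃ P : ℤ[X], Ψ k = expand ℤ 2 P := by
    intro k hk
    apply exists_expand
    rw [psi_comp hΨmonic hΨprod k (by omega), psi_deg hΨ1 hΨmonic hΨprod k (by omega),
      (Nat.totient_even (by omega)).neg_one_pow, one_mul]
  rcases hm.eq_or_lt with rfl | hm3
  · refine ⟨(Ψ n).eval 0, ?_, ?_⟩
    · have hc : Continuous (fun x : ℝ => aeval x (Ψ n)) := (Ψ n).continuous_aeval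
      have ht : Filter.Tendsto (fun x : ℝ => aeval x (Ψ n)) (nhdsWithin 0 (Set.Ioi 0))
        (nhds (aeval (0 : ℝ) (Ψ n))) := hc.continuousAt.tendsto.mono_left nhdsWithin_le_nhds
      have h0 : 0 ≤ aeval (0 : ℝ) (Ψ n) := by
        refine ge_of_tendsto ht ?_
        filter_upwards [self_mem_nhdsWithin] with x hx
        exact (psi_pos hΨprod x hx n (by omega)).le
      have e : aeval (0 : ℝ) (Ψ n) = (((Ψ n).eval 0 : ℤ) : ℝ) := by
        simpa using aeval_algebraMap_apply ℝ (0 : ℤ) (Ψ n)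
      rw [e] at h0
      exact_mod_cast h0
    · have h2 := hΨprod 2 (by norm_num)
      have hX : Ψ 2 = X := by
        rw [fp_rec, zero_add, fp_one, fp_zero, Nat.Prime.divisors Nat.prime_two] at h2
        simp [hΨ1] at h2
        exact h2.symm
      unfold rootProd
      rw [hX]
      simp [eval_zero_map]
  · obtain ⟨P, hP⟩ := hev m hm3
    obtain ⟨Q, hQ⟩ := hev n (by omega)
    have hPm : P.Monic := by
      have := hΨmonic m (by omega)
      rw [hP] at this
      exact (monic_expand_iff (by norm_num)).1 this
    obtain ⟨s, hs⟩ := rootProd_int P Q hPm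
    exact ⟨s ^ 2, sq_nonneg s, by rw [hP, hQ, rootProd_expand P Q hPm, hs]; push_cast; rfl⟩

theorem rootProd_psi_norm
    (Ψ : ℕ → Polynomial ℤ) (hΨ1 : Ψ 1 = 1)
    (hΨmonic : ∀ n, 1 ≤ n → (Ψ n).Monic)
    (hΨprod : ∀ n, 1 ≤ n → fibPoly n = ∏ d ∈ n.divisors, Ψ d)
    (m p α : ℕ) (hm : 2 ≤ m) (hp : p.Prime) :
    ‖rootProd (Ψ m) (Ψ (m * p ^ (α + 1)))‖ = (p : ℝ) ^ Nat.totient m := by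
  have hN : 1 ≤ m * p ^ α := Nat.mul_pos (by omega) (pow_pos hp.pos _)
  have hmm := hΨmonic m (by omega)
  obtain ⟨k, hk⟩ : ∃ k, p = k + 1 := ⟨p - 1, by have := hp.pos; omega⟩
  have hq := psi_quot hΨmonic hΨprod (m * p ^ α) k hN
  rw [← hk, mul_assoc, ← pow_succ] at hq
  have hdvd := psi_dvd_fp hΨprod m (m * p ^ α) hN (dvd_mul_right _ _)
  have h1 := rootProd_congr _ _ _ (hdvd.trans hq)
  have hmem : m * p ^ (α + 1) ∈ (m * p ^ (α + 1)).divisors \ (m * p ^ α).divisors := by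
    simp only [Finset.mem_sdiff, Nat.mem_divisors]
    refine ⟨⟨dvd_rfl, Nat.mul_ne_zero (by omega) (pow_ne_zero _ hp.ne_zero)⟩, fun h => ?_⟩
    have h3 := Nat.dvd_of_mul_dvd_mul_left (by omega) h.1
    have := (Nat.pow_dvd_pow_iff_le_right hp.one_lt).1 h3
    omega
  rw [← Finset.mul_prod_erase _ _ hmem, rootProd_mul, rootProd_mul, rootProd_nat _ hmm,
    psi_deg hΨ1 hΨmonic hΨprod m hm] at h1
  have h2 := rootProd_coprime (Ψ m) (∏ e ∈ ((m * p ^ (α + 1)).divisors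
      \ (m * p ^ α).divisors).erase (m * p ^ (α + 1)), Ψ e) hmm (by
    refine IsCoprime.prod_right fun d hd => ?_
    simp only [Finset.mem_erase, Finset.mem_sdiff, Nat.mem_divisors] at hd
    obtain ⟨hd1, ⟨hd2, hd3⟩, hd4⟩ := hd
    have hd5 : ¬ d ∣ m * p ^ α := fun h => hd4 ⟨h, by omega⟩
    refine psi_coprime hΨmonic hΨprod m d (by omega)
      (Nat.pos_of_dvd_of_pos hd2 (by omega)) ?_ (fun h => hd5 (h.mul_right _))
    rintro ⟨c, rfl⟩
    have hc := Nat.dvd_of_mul_dvd_mul_left (by omega) hd2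
    obtain ⟨j, hj, rfl⟩ := (Nat.dvd_prime_pow hp).1 hc
    rcases hj.eq_or_lt with rfl | hj
    · exact hd1 rfl
    · exact hd5 (Nat.mul_dvd_mul_left _ (pow_dvd_pow _ (by omega))))
  have h3 := rootProd_coprime (Ψ m) (fibPoly (m * p ^ α + 1) ^ k) hmm
    ((fp_coprime (m * p ^ α)).of_isCoprime_of_dvd_left hdvd).pow_right
  have h4 := congrArg norm h1
  rw [norm_mul, norm_mul, h2, h3, mul_one, mul_one] at h4
  rw [h4]; simp

theorem fibotomic_res
    (Ψ : ℕ → Polynomial ℤ) (hΨ1 : Ψ 1 = 1)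
    (hΨmonic : ∀ n, 1 ≤ n → (Ψ n).Monic)
    (hΨprod : ∀ n, 1 ≤ n → fibPoly n = ∏ d ∈ n.divisors, Ψ d)
    (m n : ℕ) (hm : 2 ≤ m) (hmn : m < n) :
    (∀ p α : ℕ, p.Prime → 0 < α → n = m * p ^ α →
      resC ((Ψ m).map (Int.castRingHom ℂ)) ((Ψ n).map (Int.castRingHom ℂ)) =
        (p : ℂ) ^ Nat.totient m) ∧
    ((¬∃ p α : ℕ, p.Prime ∧ 0 < α ∧ n = m * p ^ α) →
      resC ((Ψ m).map (Int.castRingHom ℂ)) ((Ψ n).map (Int.castRingHom ℂ)) = 1) := by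
  have hmonic := hΨmonic n (by omega)
  obtain ⟨r, hr0, hr⟩ := rootProd_psi_nonneg Ψ hΨ1 hΨmonic hΨprod m n hm hmn
  have hnorm : ‖rootProd (Ψ m) (Ψ n)‖ = (r : ℝ) := by
    rw [hr, Complex.norm_intCast, abs_of_nonneg (by exact_mod_cast hr0)]
  rw [resC_eq _ _ hmonic]
  constructor
  · intro p α hp hα h
    obtain ⟨β, rfl⟩ : ∃ β, α = β + 1 := ⟨α - 1, by omega⟩
    have h1 := rootProd_psi_norm Ψ hΨ1 hΨmonic hΨprod m p β hm hp
    rw [← h, hnorm] at h1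
    have h2 : r = (p : ℤ) ^ Nat.totient m := by exact_mod_cast h1
    rw [hr, h2]; push_cast; rfl
  · intro h
    have h1 := rootProd_coprime _ _ (hΨmonic m (by omega))
      (psi_coprime' hΨmonic hΨprod m n (by omega) hmn h)
    rw [hnorm] at h1
    have h2 : r = 1 := by exact_mod_cast h1
    rw [hr, h2]; simp
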